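/- arXiv:1610.07919 — 4 statements merged into one kernel-verified Lean document; each statement's English description precedes it below -/
import Mathlib

section
/- Let $S^7$ denote the unit sphere in the Euclidean space $\mathbb{C}^4$ (i.e. `Metric.sphere 0 1` in `EuclideanSpace ℂ (Fin 4)`), and let $\mathbb{CP}^3$ denote the quotient of $S^7$ by the action of the group of unit complex numbers acting by scalar multiplication, equipped with the quotient topology. Then the second homotopy group $\pi_2(\mathbb{CP}^3)$ (at any basepoint) is isomorphic to $\mathbb{Z}$. -/
/-- The unit sphere `S⁷` in `ℂ⁴`. -/
noncomputable abbrev S7 := Metric.sphere (0 : EuclideanSpace ℂ (Fin 4)) 1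

/-- The setoid on `S⁷` whose classes are the orbits of the scalar action of the
group `Circle` of unit complex numbers. -/
noncomputable def hopfSetoid : Setoid S7 where
  r x y := ∃ z : Circle, z • (x : EuclideanSpace ℂ (Fin 4)) = (y : EuclideanSpace ℂ (Fin 4))
  iseqv := by
    constructor
    · intro x; exact ⟨1, one_smul _ _⟩
    · rintro x y ⟨z, hz⟩; exact ⟨z⁻¹, by rw [← hz, inv_smul_smul]⟩
    · rintro x y w ⟨z₁, h₁⟩ ⟨z₂, h₂⟩; exact ⟨z₂ * z₁, by rw [mul_smul, h₁, h₂]⟩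

/-- Complex projective 3-space, as the quotient of `S⁷` by the circle action,
with the quotient topology. -/
noncomputable def CP3 : Type := Quotient hopfSetoid

noncomputable instance : TopologicalSpace CP3 :=
  inferInstanceAs (TopologicalSpace (Quotient hopfSetoid))

section

open Topology unitInterval Topology.Homotopy

/-- The map to the unit sphere obtained by normalizing a nowhere vanishing map. -/
noncomputable def normalizeMap {X E : Type*} [TopologicalSpace X] [NormedAddCommGroup E]
    [NormedSpace ℝ E] (g : X → E) (hg : Continuous g) (hne : ∀ x, g x ≠ 0) :
    C(X, Metric.sphere (0 : E) 1) where
  toFun x := ⟨‖g x‖⁻¹ • g x, by simp [norm_smul, hne x]⟩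
  continuous_toFun := by
    refine Continuous.subtype_mk (Continuous.smul (hg.norm.inv₀ fun x => ?_) hg) _
    simpa using hne x

theorem normalizeMap_eq {X E : Type*} [TopologicalSpace X] [NormedAddCommGroup E]
    [NormedSpace ℝ E] {g : X → E} (hg : Continuous g) (hne : ∀ x, g x ≠ 0) {x : X}
    {v : Metric.sphere (0 : E) 1} (h : g x = v) : normalizeMap g hg hne x = v := by
  ext
  simp [normalizeMap, h]

/-- A generalized loop in a sphere that misses a point is null-homotopic. -/
theorem genLoop_sphere_homotopic_const_of_ne {N E : Type*} [NormedAddCommGroup E]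
    [InnerProductSpace ℝ E] {x₀ : Metric.sphere (0 : E) 1}
    (f : Ω^ N (Metric.sphere (0 : E) 1) x₀) (v : Metric.sphere (0 : E) 1)
    (hf : ∀ t, f t ≠ v) (hx : x₀ ≠ v) : GenLoop.Homotopic f GenLoop.const := by
  set e := stereographic (norm_eq_of_mem_sphere v) with he
  have hsrc : ∀ y, y ≠ v → y ∈ e.source := fun y hy => by simpa [he] using hy
  have hsymm : Continuous e.symm := by
    rw [← continuousOn_univ]
    simpa [he] using e.continuousOn_symm
  have hef : Continuous fun t => e (f t) :=
    e.continuousOn.comp_continuous (map_continuous f.1) fun t => hsrc _ (hf t)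
  refine ⟨⟨⟨⟨fun p => e.symm ((1 - (p.1 : ℝ)) • e (f p.2) + (p.1 : ℝ) • e x₀), ?_⟩, ?_, ?_⟩, ?_⟩⟩
  · have hs : Continuous fun p : I × (N → I) => (p.1 : ℝ) := by fun_prop
    exact hsymm.comp (((continuous_const.sub hs).smul (hef.comp continuous_snd)).add
      (hs.smul continuous_const))
  · intro t
    simpa using e.left_inv (hsrc _ (hf t))
  · intro t
    simpa using e.left_inv (hsrc _ hx)
  · intro s t ht
    have : f.1 t = x₀ := f.2 t ht
    have h' : f t = x₀ := this
    simp only [ContinuousMap.coe_mk, this, h', ← add_smul, sub_add_cancel, one_smul]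
    exact e.left_inv (hsrc _ hx)

/-- Spheres of dimension greater than `n` have trivial `n`-th homotopy group. -/
theorem genLoop_sphere_homotopic_const {N E : Type*} [Fintype N] [Nonempty N]
    [NormedAddCommGroup E] [InnerProductSpace ℝ E] [FiniteDimensional ℝ E]
    (h : Fintype.card N + 1 < Module.finrank ℝ E) {x₀ : Metric.sphere (0 : E) 1}
    (f : Ω^ N (Metric.sphere (0 : E) 1) x₀) : GenLoop.Homotopic f GenLoop.const := by
  let c : (N → ℝ) → (N → I) := fun t i => Set.projIcc 0 1 zero_le_one (t i)
  let ι : (N → I) → (N → ℝ) := fun t i => t i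
  have hc : Continuous c := by
    refine continuous_pi fun i => continuous_projIcc.comp (continuous_apply i)
  have hι : Continuous ι := by fun_prop
  have hcι : ∀ t, c (ι t) = t := fun t => by
    ext i
    simp [c, ι]
  have hfc : Continuous fun t : N → ℝ => (f (c t) : E) - x₀ :=
    (continuous_subtype_val.comp ((map_continuous f.1).comp hc)).sub continuous_const
  obtain ⟨g, hg, hgf, hgs⟩ := hfc.exists_contDiff_approx 1 (continuous_const (y := (1 : ℝ)))
    fun _ => one_pos
  have hgb : ∀ t ∈ Cube.boundary N, g (ι t) = 0 := fun t ht => by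
    by_contra hne
    refine hgs hne ?_
    simp [hcι, GenLoop.boundary f t ht]
  have hgc : Continuous fun t => (x₀ : E) + g (ι t) :=
    continuous_const.add (hg.continuous.comp hι)
  have hclose : ∀ t, ‖(x₀ : E) + g (ι t) - f t‖ < 1 := fun t => by
    have := hgf (ι t)
    rw [dist_eq_norm, hcι] at this
    convert! this using 2
    abel
  have hne : ∀ p : I × (N → I),
      (f p.2 : E) + (p.1 : ℝ) • ((x₀ : E) + g (ι p.2) - f p.2) ≠ 0 := fun p h0 => by
    have h1 := norm_eq_of_mem_sphere (f p.2)
    rw [eq_neg_of_add_eq_zero_left h0, norm_neg, norm_smul, Real.norm_of_nonneg p.1.2.1] at h1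
    nlinarith [hclose p.2, p.1.2.1, p.1.2.2, norm_nonneg ((x₀ : E) + g (ι p.2) - f p.2)]
  have hH : Continuous fun p : I × (N → I) =>
      (f p.2 : E) + (p.1 : ℝ) • ((x₀ : E) + g (ι p.2) - f p.2) := by
    have hf' : Continuous fun p : I × (N → I) => (f p.2 : E) :=
      continuous_subtype_val.comp ((map_continuous f.1).comp continuous_snd)
    exact hf'.add ((by fun_prop : Continuous fun p : I × (N → I) => (p.1 : ℝ)).smul
      ((hgc.comp continuous_snd).sub hf'))
  have hne1 : ∀ t, (x₀ : E) + g (ι t) ≠ 0 := fun t => by simpa using hne (1, t)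
  let u : Ω^ N (Metric.sphere (0 : E) 1) x₀ :=
    ⟨normalizeMap _ hgc hne1, fun t ht => normalizeMap_eq hgc hne1 (by simp [hgb t ht])⟩
  have hfu : GenLoop.Homotopic f u := by
    refine ⟨⟨⟨normalizeMap _ hH hne, fun t => normalizeMap_eq hH hne (by simp), fun t => ?_⟩, ?_⟩⟩
    · ext
      simp [u, normalizeMap]
      rw [← smul_add, ← smul_add, add_sub_cancel]
    · intro s t ht
      exact normalizeMap_eq hH hne (by simp [hgb t ht, GenLoop.boundary f t ht])
  refine hfu.trans ?_
  have hcone : ContDiff ℝ 1 fun q : ℝ × (N → ℝ) => q.1 • ((x₀ : E) + g q.2) :=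
    contDiff_fst.smul (contDiff_const.add (hg.comp contDiff_snd))
  obtain ⟨p, hp⟩ := (hcone.dense_compl_range_of_finrank_lt_finrank
    (by simpa [add_comm] using h)).nonempty
  have hp0 : p ≠ 0 := fun h0 => hp ⟨(0, 0), by simp [h0]⟩
  have huv : ∀ t, u t ≠ ⟨‖p‖⁻¹ • p, by simp [norm_smul, hp0]⟩ := fun t ht => hp
    ⟨(‖p‖ * ‖(x₀ : E) + g (ι t)‖⁻¹, ι t), by
      have h1 : ‖(x₀ : E) + g (ι t)‖⁻¹ • ((x₀ : E) + g (ι t)) = ‖p‖⁻¹ • p :=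
        congrArg Subtype.val ht
      simp only [mul_smul, h1]
      rw [smul_inv_smul₀ (norm_ne_zero_iff.2 hp0)]⟩
  refine genLoop_sphere_homotopic_const_of_ne u _ huv ?_
  have h0 : (0 : N → I) ∈ Cube.boundary N := ⟨Classical.arbitrary N, Or.inl rfl⟩
  rw [← GenLoop.boundary u 0 h0]
  exact huv 0

/-- The quotient map `S⁷ → ℂP³`. -/
noncomputable def hopfMap (x : S7) : CP3 := Quotient.mk hopfSetoid x

/-- The action of the circle group on `S⁷`. -/
noncomputable def hopfRotate (z : Circle) (x : S7) : S7 :=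
  ⟨z • (x : EuclideanSpace ℂ (Fin 4)), by simp [Circle.smul_def, norm_smul, Circle.norm_coe]⟩

theorem continuous_hopfRotate : Continuous fun p : Circle × S7 => hopfRotate p.1 p.2 := by
  refine Continuous.subtype_mk ?_ _
  simp only [Circle.smul_def]
  fun_prop

theorem hopfMap_rotate (z : Circle) (x : S7) : hopfMap (hopfRotate z x) = hopfMap x :=
  (Quotient.sound (s := hopfSetoid) ⟨z, rfl⟩ : hopfMap x = hopfMap (hopfRotate z x)).symm

theorem hopfRotate_one (x : S7) : hopfRotate 1 x = x := by
  ext1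
  simp [hopfRotate]

theorem hopfRotate_rotate (z w : Circle) (x : S7) :
    hopfRotate z (hopfRotate w x) = hopfRotate (z * w) x := by
  ext1
  simp [hopfRotate, mul_smul]

theorem exists_rotate_of_hopfMap_eq {x y : S7} (h : hopfMap x = hopfMap y) :
    ∃ z, hopfRotate z x = y := by
  obtain ⟨z, hz⟩ := Quotient.exact (s := hopfSetoid) h
  exact ⟨z, Subtype.ext hz⟩

theorem inner_hopfRotate (z : Circle) (x : S7) :
    inner ℂ (x : EuclideanSpace ℂ (Fin 4)) (hopfRotate z x) = (z : ℂ) := by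
  simp [hopfRotate, Circle.smul_def]

theorem isOpenQuotientMap_hopfMap : IsOpenQuotientMap hopfMap := by
  have hq : IsQuotientMap hopfMap := isQuotientMap_quot_mk
  refine ⟨hq.surjective, hq.continuous, fun U hU => ?_⟩
  rw [← hq.isOpen_preimage]
  have : hopfMap ⁻¹' (hopfMap '' U) = ⋃ z : Circle, (hopfRotate z) ⁻¹' U := by
    ext x
    simp only [Set.mem_preimage, Set.mem_image, Set.mem_iUnion]
    constructor
    · rintro ⟨y, hy, hyx⟩
      obtain ⟨z, rfl⟩ := exists_rotate_of_hopfMap_eq hyx.symm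
      exact ⟨z, hy⟩
    · rintro ⟨z, hz⟩
      exact ⟨_, hz, hopfMap_rotate z x⟩
  rw [this]
  exact isOpen_iUnion fun z => hU.preimage
    (continuous_hopfRotate.comp (by fun_prop : Continuous fun x : S7 => (z, x)))

/-- The absolute value of the Hermitian product of representatives of two points of `ℂP³`. -/
noncomputable def cp3Overlap : CP3 → CP3 → ℝ :=
  Quotient.lift₂ (s₁ := hopfSetoid) (s₂ := hopfSetoid)
    (fun x y => ‖inner ℂ (x : EuclideanSpace ℂ (Fin 4)) y‖) (by
      rintro x y x' y' ⟨z, hz⟩ ⟨w, hw⟩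
      simp [← hz, ← hw, Circle.smul_def, Circle.norm_coe])

theorem continuous_cp3Overlap : Continuous fun p : CP3 × CP3 => cp3Overlap p.1 p.2 := by
  rw [← (isOpenQuotientMap_hopfMap.prodMap isOpenQuotientMap_hopfMap).continuous_comp_iff]
  change Continuous fun p : S7 × S7 => ‖inner ℂ (p.1 : EuclideanSpace ℂ (Fin 4)) p.2‖
  fun_prop

theorem cp3Overlap_self (q : CP3) : cp3Overlap q q = 1 := by
  obtain ⟨x, rfl⟩ := isOpenQuotientMap_hopfMap.surjective q
  change ‖inner ℂ (x : EuclideanSpace ℂ (Fin 4)) x‖ = 1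
  simp

/-- The representative of a point of `ℂP³` whose Hermitian product with `x` is positive;
it is `0` when the point is orthogonal to `x`. -/
noncomputable def hopfTransport (x : S7) : CP3 → EuclideanSpace ℂ (Fin 4) :=
  Quotient.lift (s := hopfSetoid)
    (fun y => (inner ℂ (y : EuclideanSpace ℂ (Fin 4)) x /
      (‖inner ℂ (y : EuclideanSpace ℂ (Fin 4)) x‖ : ℂ)) • (y : EuclideanSpace ℂ (Fin 4))) (by
      rintro y y' ⟨z, hz⟩
      have : (starRingEnd ℂ) (z : ℂ) * z = 1 := by simp [← Complex.normSq_eq_conj_mul_self]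
      simp only [← hz, Circle.smul_def, inner_smul_left, norm_mul, RCLike.norm_conj,
        Circle.norm_coe, one_mul, smul_smul]
      congr 1
      linear_combination (-(inner ℂ (y : EuclideanSpace ℂ (Fin 4)) x /
        (‖inner ℂ (y : EuclideanSpace ℂ (Fin 4)) x‖ : ℂ))) * this)

theorem hopfTransport_mk (x y : S7) : hopfTransport x (hopfMap y) =
    (inner ℂ (y : EuclideanSpace ℂ (Fin 4)) x /
      (‖inner ℂ (y : EuclideanSpace ℂ (Fin 4)) x‖ : ℂ)) • (y : EuclideanSpace ℂ (Fin 4)) := rfl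

theorem hopfTransport_self (x : S7) : hopfTransport x (hopfMap x) = x := by
  simp [hopfTransport_mk]

theorem exists_hopfMap_eq_hopfTransport {x : S7} {q : CP3} (h : cp3Overlap (hopfMap x) q ≠ 0) :
    ∃ y : S7, (y : EuclideanSpace ℂ (Fin 4)) = hopfTransport x q ∧ hopfMap y = q := by
  obtain ⟨y, rfl⟩ := isOpenQuotientMap_hopfMap.surjective q
  replace h : ‖inner ℂ (x : EuclideanSpace ℂ (Fin 4)) y‖ ≠ 0 := h
  rw [norm_inner_symm] at h
  refine ⟨hopfRotate ⟨inner ℂ (y : EuclideanSpace ℂ (Fin 4)) x /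
      (‖inner ℂ (y : EuclideanSpace ℂ (Fin 4)) x‖ : ℂ), ?_⟩ y, rfl, hopfMap_rotate _ _⟩
  simp [Submonoid.unitSphere, div_self h]

theorem continuousAt_hopfTransport {x : S7} {q : CP3} (h : cp3Overlap (hopfMap x) q ≠ 0) :
    ContinuousAt (fun p : S7 × CP3 => hopfTransport p.1 p.2) (x, q) := by
  obtain ⟨y, rfl⟩ := isOpenQuotientMap_hopfMap.surjective q
  replace h : ‖inner ℂ (x : EuclideanSpace ℂ (Fin 4)) y‖ ≠ 0 := h
  rw [norm_inner_symm] at h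
  have := (IsOpenQuotientMap.id.prodMap isOpenQuotientMap_hopfMap).continuousAt_comp_iff
    (g := fun p : S7 × CP3 => hopfTransport p.1 p.2) (x := (x, y))
  refine this.1 ?_
  have hphase : ContinuousAt (fun p : S7 × S7 => inner ℂ (p.2 : EuclideanSpace ℂ (Fin 4)) p.1 /
      (‖inner ℂ (p.2 : EuclideanSpace ℂ (Fin 4)) p.1‖ : ℂ)) (x, y) :=
    ContinuousAt.div (Continuous.continuousAt (by fun_prop))
      (Continuous.continuousAt (by fun_prop)) (by simpa using h)
  have hsnd : ContinuousAt (fun p : S7 × S7 => (p.2 : EuclideanSpace ℂ (Fin 4))) (x, y) :=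
    Continuous.continuousAt (by fun_prop)
  exact hphase.smul hsnd

/-- Along a homotopy of maps from a compact space to `ℂP³`, nearby stages are nowhere orthogonal. -/
theorem exists_cp3Overlap_ne_zero {Y : Type*} [TopologicalSpace Y] [CompactSpace Y]
    (K : C(I × Y, CP3)) :
    ∃ δ > 0, ∀ s t : I, dist s t < δ → ∀ y, cp3Overlap (K (s, y)) (K (t, y)) ≠ 0 := by
  have hc : Continuous fun p : (I × I) × Y => cp3Overlap (K (p.1.1, p.2)) (K (p.1.2, p.2)) :=
    continuous_cp3Overlap.comp (by fun_prop :
      Continuous fun p : (I × I) × Y => (K (p.1.1, p.2), K (p.1.2, p.2)))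
  have hcomp : IsCompact {p : (I × I) × Y | cp3Overlap (K (p.1.1, p.2)) (K (p.1.2, p.2)) = 0} :=
    (isClosed_eq hc continuous_const).isCompact
  rcases Set.eq_empty_or_nonempty
    {p : (I × I) × Y | cp3Overlap (K (p.1.1, p.2)) (K (p.1.2, p.2)) = 0} with he | hne
  · exact ⟨1, one_pos, fun s t _ y h0 => Set.eq_empty_iff_forall_notMem.1 he ((s, t), y) h0⟩
  obtain ⟨p, hp, hmin⟩ := hcomp.exists_isMinOn hne
    (by fun_prop : Continuous fun p : (I × I) × Y => dist p.1.1 p.1.2).continuousOn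
  refine ⟨dist p.1.1 p.1.2, dist_pos.2 fun heq => ?_, fun s t hst y h0 => ?_⟩
  · have hp' : cp3Overlap (K (p.1.1, p.2)) (K (p.1.2, p.2)) = 0 := hp
    rw [heq, cp3Overlap_self] at hp'
    exact one_ne_zero hp'
  · exact absurd hst (not_lt.2 (hmin (a := ((s, t), y)) h0))

/-- The end of a homotopy in `ℂP³` lifts to `S⁷` if its beginning does. -/
theorem exists_hopf_lift_end {Y : Type*} [TopologicalSpace Y] [CompactSpace Y]
    (K : C(I × Y, CP3)) (F₀ : C(Y, S7)) (h₀ : ∀ y, hopfMap (F₀ y) = K (0, y)) :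
    ∃ F : C(Y, S7), (∀ y, hopfMap (F y) = K (1, y)) ∧
      ∀ y, (∀ t, K (t, y) = K (0, y)) → F y = F₀ y := by
  obtain ⟨δ, hδ, hK⟩ := exists_cp3Overlap_ne_zero K
  obtain ⟨n, hn⟩ := exists_nat_one_div_lt hδ
  let τ : ℕ → I := fun k => Set.projIcc 0 1 zero_le_one ((k : ℝ) / (n + 1))
  have hτ0 : τ 0 = 0 := by simp [τ]
  have hτ1 : τ (n + 1) = 1 := by
    have : ((n + 1 : ℕ) : ℝ) / (n + 1) = 1 := by
      push_cast
      exact div_self (by positivity)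
    simp only [τ, this, Set.projIcc_right]
    rfl
  have hτ : ∀ k, dist (τ k) (τ (k + 1)) < δ := fun k => by
    refine lt_of_le_of_lt (Set.abs_projIcc_sub_projIcc zero_le_one) ?_
    have : (k : ℝ) / (n + 1) - ((k + 1 : ℕ) : ℝ) / (n + 1) = -(1 / (n + 1)) := by
      push_cast
      ring
    rwa [this, abs_neg, abs_of_pos (by positivity)]
  suffices H : ∀ k, ∃ F : C(Y, S7), (∀ y, hopfMap (F y) = K (τ k, y)) ∧
      ∀ y, (∀ t, K (t, y) = K (0, y)) → F y = F₀ y by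
    simpa only [hτ1] using H (n + 1)
  intro k
  induction k with
  | zero => exact ⟨F₀, by simpa only [hτ0] using h₀, fun _ _ => rfl⟩
  | succ k ih =>
    obtain ⟨F, hF, hst⟩ := ih
    have hov : ∀ y, cp3Overlap (hopfMap (F y)) (K (τ (k + 1), y)) ≠ 0 := fun y => by
      rw [hF]
      exact hK _ _ (hτ k) y
    choose G hG hGK using fun y => exists_hopfMap_eq_hopfTransport (hov y)
    have hGc : Continuous G := by
      refine continuous_induced_rng.2 (continuous_iff_continuousAt.2 fun y => ?_)
      have h := (continuousAt_hopfTransport (hov y)).comp (f := fun y => (F y, K (τ (k + 1), y)))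
        (x := y) (Continuous.continuousAt (by fun_prop))
      exact h.congr (Filter.Eventually.of_forall fun y => (hG y).symm)
    refine ⟨⟨G, hGc⟩, hGK, fun y hy => ?_⟩
    rw [← hst y hy]
    ext1
    change (G y : EuclideanSpace ℂ (Fin 4)) = F y
    rw [hG, hy, ← hy (τ k), ← hF, hopfTransport_self]

/-- Homotopies in `ℂP³` lift to `S⁷`, and the lift is stationary wherever the homotopy is. -/
theorem exists_hopf_lift {X : Type*} [TopologicalSpace X] [CompactSpace X]
    (H : C(I × X, CP3)) (F₀ : C(X, S7)) (h₀ : ∀ x, hopfMap (F₀ x) = H (0, x)) :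
    ∃ F : C(I × X, S7), (∀ p, hopfMap (F p) = H p) ∧ (∀ x, F (0, x) = F₀ x) ∧
      ∀ x, (∀ t, H (t, x) = H (0, x)) → ∀ t, F (t, x) = F₀ x := by
  obtain ⟨F, hF, hst⟩ := exists_hopf_lift_end
    (H.comp ⟨fun p : I × (I × X) => (p.1 * p.2.1, p.2.2), by fun_prop⟩)
    (F₀.comp ⟨Prod.snd, continuous_snd⟩) fun p => by simpa using h₀ p.2
  exact ⟨F, fun p => by simpa using hF p, fun x => hst _ fun t => by simp,
    fun x hx t => hst _ fun s => by simpa using hx _⟩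

theorem genLoop_S7_homotopic_const {N : Type*} [Fintype N] [Nonempty N]
    (hN : Fintype.card N ≤ 6) {x₀ : S7} (f : Ω^ N S7 x₀) :
    GenLoop.Homotopic f GenLoop.const := by
  let := InnerProductSpace.rclikeToReal ℂ (EuclideanSpace ℂ (Fin 4))
  refine genLoop_sphere_homotopic_const ?_ f
  have h : Module.finrank ℝ (EuclideanSpace ℂ (Fin 4)) =
      2 * Module.finrank ℂ (EuclideanSpace ℂ (Fin 4)) :=
    finrank_real_of_complex (EuclideanSpace ℂ (Fin 4))
  rw [finrank_euclideanSpace_fin] at h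
  exact lt_of_lt_of_eq (by lia) h.symm

/-- Two lifts to `S⁷` of the same map differ by a continuous function to the circle. -/
theorem exists_eq_hopfRotate {Y : Type*} [TopologicalSpace Y] (F G : C(Y, S7))
    (h : ∀ y, hopfMap (F y) = hopfMap (G y)) :
    ∃ c : C(Y, Circle), ∀ y, hopfRotate (c y) (F y) = G y := by
  choose c hc using fun y => exists_rotate_of_hopfMap_eq (h y)
  refine ⟨⟨c, continuous_induced_rng.2 ?_⟩, hc⟩
  have : (Subtype.val ∘ c : Y → ℂ) = fun y =>
      inner ℂ (F y : EuclideanSpace ℂ (Fin 4)) (G y : EuclideanSpace ℂ (Fin 4)) := by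
    ext y
    rw [← hc y, inner_hopfRotate]
    rfl
  change Continuous (Subtype.val ∘ c : Y → ℂ)
  rw [this]
  fun_prop

theorem eq_of_circle_exp_eq_one (θ : C(I, ℝ)) (h : ∀ s, Circle.exp (θ s) = 1) (s : I) :
    θ s = θ 0 :=
  Circle.isCoveringMap_exp.const_of_comp θ.continuous
    (fun a b => by simp only [h]) s 0

/-- Concatenation of two families of paths. -/
theorem exists_concat {Y Z : Type*} [TopologicalSpace Y] [TopologicalSpace Z] (a b : C(Y × I, Z))
    (h : ∀ y, a (y, 1) = b (y, 0)) :
    ∃ c : C(Y × I, Z), ∀ y (s : I), c (y, s) =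
      if (s : ℝ) ≤ 1 / 2 then a (y, Set.projIcc 0 1 zero_le_one (2 * s))
      else b (y, Set.projIcc 0 1 zero_le_one (2 * s - 1)) := by
  refine ⟨⟨fun p => if (p.2 : ℝ) ≤ 1 / 2 then a (p.1, Set.projIcc 0 1 zero_le_one (2 * p.2))
      else b (p.1, Set.projIcc 0 1 zero_le_one (2 * p.2 - 1)), ?_⟩, fun _ _ => rfl⟩
  refine Continuous.if_le ?_ ?_ (by fun_prop) continuous_const fun p hp => ?_
  · exact a.continuous.comp (continuous_fst.prodMk (continuous_projIcc.comp (by fun_prop)))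
  · exact b.continuous.comp (continuous_fst.prodMk (continuous_projIcc.comp (by fun_prop)))
  · have h1 : (2 : ℝ) * p.2 = 1 := by rw [hp]; norm_num
    rw [h1, sub_self, Set.projIcc_left, Set.projIcc_right]
    exact h p.1

/-- The relation that `n` is the degree of the boundary, as a loop in the fibre over the base
point, of a lift of `f` to `S⁷` which is constant on three sides of the square. -/
def HopfDegree (x₀ : S7) (f : Ω^ (Fin 2) CP3 (hopfMap x₀)) (n : ℤ) : Prop :=
  ∃ (F : C(I × I, S7)) (θ : C(I, ℝ)), (∀ t s, hopfMap (F (t, s)) = f ![s, t]) ∧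
    (∀ s, F (0, s) = x₀) ∧ (∀ t, F (t, 0) = x₀) ∧ (∀ t, F (t, 1) = x₀) ∧
    (∀ s, F (1, s) = hopfRotate (Circle.exp (θ s)) x₀) ∧
    θ 0 = 0 ∧ θ 1 = n * (2 * Real.pi)

theorem mem_boundary_fin_two {y : Fin 2 → I} :
    y ∈ Cube.boundary (Fin 2) ↔ y 0 = 0 ∨ y 0 = 1 ∨ y 1 = 0 ∨ y 1 = 1 :=
  Fin.exists_fin_two.trans (or_assoc (a := y 0 = 0))

theorem square_mem_boundary {s t : I} (h : s = 0 ∨ s = 1 ∨ t = 0 ∨ t = 1) :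
    ![s, t] ∈ Cube.boundary (Fin 2) :=
  mem_boundary_fin_two.2 h

theorem hopfRotate_injective {z w : Circle} {x : S7} (h : hopfRotate z x = hopfRotate w x) :
    z = w := by
  ext
  rw [← inner_hopfRotate z x, h, inner_hopfRotate]

theorem exists_hopfDegree (x₀ : S7) (f : Ω^ (Fin 2) CP3 (hopfMap x₀)) : ∃ n, HopfDegree x₀ f n := by
  have hb : ∀ s t : I, (s = 0 ∨ s = 1 ∨ t = 0 ∨ t = 1) → f ![s, t] = hopfMap x₀ := fun s t h =>
    f.2 _ (square_mem_boundary h)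
  obtain ⟨F, hF, hF0, hst⟩ := exists_hopf_lift
    (f.1.comp ⟨fun p : I × I => ![p.2, p.1], by fun_prop⟩) (.const I x₀)
    fun s => (hb s 0 (by simp)).symm
  have hside : ∀ s : I, (s = 0 ∨ s = 1) → ∀ t, F (t, s) = x₀ := fun s hs t => hst s
    (fun t => (hb s t (by tauto)).trans (hb s 0 (by simp)).symm) t
  obtain ⟨c, hc⟩ := exists_eq_hopfRotate (.const I x₀) (F.comp ⟨fun s => (1, s), by fun_prop⟩)
    fun s => ((hF (1, s)).trans (hb s 1 (by simp))).symm
  have hc1 : ∀ s, F (1, s) = x₀ → c s = 1 := fun s hs =>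
    hopfRotate_injective (x := x₀) (((hc s).trans hs).trans (hopfRotate_one x₀).symm)
  obtain ⟨θ, hθ, hθ0⟩ := Circle.isCoveringMap_exp.exists_path_lifts c 0
    (by rw [Circle.exp_zero]; exact hc1 0 (hside 0 (by simp) 1))
  have hθ' : ∀ s, Circle.exp (θ s) = c s := congrFun hθ
  have h1 : Circle.exp (θ 1) = 1 := by rw [hθ', hc1 1 (hside 1 (by simp) 1)]
  obtain ⟨n, hn⟩ := Circle.exp_eq_one.1 h1
  exact ⟨n, F, θ, fun t s => hF (t, s), hF0, hside 0 (by simp), hside 1 (by simp),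
    fun s => by rw [hθ']; exact (hc s).symm, hθ0, hn⟩

theorem HopfDegree.eq_of_homotopic {x₀ : S7} {f g : Ω^ (Fin 2) CP3 (hopfMap x₀)} {n m : ℤ}
    (hf : HopfDegree x₀ f n) (hg : HopfDegree x₀ g m) (hfg : GenLoop.Homotopic f g) : n = m := by
  obtain ⟨F, θ, hF, hF0, hFl, hFr, hFt, hθ0, hθ1⟩ := hf
  obtain ⟨G, η, hG, hG0, hGl, hGr, hGt, hη0, hη1⟩ := hg
  obtain ⟨K⟩ := hfg
  obtain ⟨L, hL, -, hst⟩ := exists_hopf_lift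
    (K.toContinuousMap.comp ⟨fun p : I × (I × I) => (p.1, ![p.2.2, p.2.1]), by fun_prop⟩) F
    fun p => (hF p.1 p.2).trans (K.apply_zero _).symm
  have hLb : ∀ s t : I, (s = 0 ∨ s = 1 ∨ t = 0 ∨ t = 1) → L (1, (t, s)) = F (t, s) :=
    fun s t h => hst (t, s) (fun u => (K.eq_fst u (square_mem_boundary h)).trans
      (K.eq_fst 0 (square_mem_boundary h)).symm) 1
  obtain ⟨c, hc⟩ := exists_eq_hopfRotate (L.comp ⟨fun p => (1, p), by fun_prop⟩) G
    fun p => ((hL (1, p)).trans (K.apply_one _)).trans (hG p.1 p.2).symm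
  replace hc : ∀ s t, hopfRotate (c (t, s)) (L (1, (t, s))) = G (t, s) := fun s t => hc (t, s)
  have hc1 : ∀ s t : I, (s = 0 ∨ s = 1 ∨ t = 0 ∨ t = 1) → F (t, s) = x₀ → G (t, s) = x₀ →
      c (t, s) = 1 := fun s t h h1 h2 => by
    have := hc s t
    rw [hLb s t h, h1, h2] at this
    exact hopfRotate_injective (this.trans (hopfRotate_one x₀).symm)
  have hcb : ∀ s, (⇑c) (0, s) = Circle.exp ((ContinuousMap.const I (0 : ℝ)) s) := fun s => by
    rw [hc1 s 0 (by simp) (hF0 s) (hG0 s)]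
    simp
  set φ := Circle.isCoveringMap_exp.liftHomotopy c (.const I 0) hcb
  have hφ : ∀ p, Circle.exp (φ p) = c p :=
    congrFun (Circle.isCoveringMap_exp.liftHomotopy_lifts c (.const I 0) hcb)
  have hφ0 : ∀ s, φ (0, s) = 0 :=
    Circle.isCoveringMap_exp.liftHomotopy_zero c (.const I 0) hcb
  have hφl : φ (1, 0) = 0 := (eq_of_circle_exp_eq_one
    (φ.comp ⟨fun t => (t, 0), by fun_prop⟩)
    (fun t => (hφ _).trans (hc1 0 t (by simp) (hFl t) (hGl t))) 1).trans (hφ0 0)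
  have hφr : φ (1, 1) = 0 := (eq_of_circle_exp_eq_one
    (φ.comp ⟨fun t => (t, 1), by fun_prop⟩)
    (fun t => (hφ _).trans (hc1 1 t (by simp) (hFr t) (hGr t))) 1).trans (hφ0 1)
  have htop := eq_of_circle_exp_eq_one
    (φ.comp ⟨fun s => (1, s), by fun_prop⟩ + θ - η) (fun s => by
      have h := hc s 1
      rw [hLb s 1 (by simp), hFt, hGt, hopfRotate_rotate] at h
      have h' := hopfRotate_injective h
      rw [← hφ, ← Circle.exp_add] at h'
      simpa [Circle.exp_sub, div_eq_one] using h') 1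
  simp only [ContinuousMap.sub_apply, ContinuousMap.add_apply, ContinuousMap.comp_apply,
    ContinuousMap.coe_mk, hφl, hφr, hθ0, hη0, hθ1, hη1] at htop
  have : ((n : ℝ) - m) * (2 * Real.pi) = 0 := by linarith
  have h2 := (mul_eq_zero.1 this).resolve_right Real.two_pi_pos.ne'
  exact_mod_cast sub_eq_zero.1 h2

theorem HopfDegree.homotopic_const {x₀ : S7} {f : Ω^ (Fin 2) CP3 (hopfMap x₀)}
    (hf : HopfDegree x₀ f 0) : GenLoop.Homotopic f GenLoop.const := by
  obtain ⟨F, θ, hF, hF0, hFl, hFr, hFt, hθ0, hθ1⟩ := hf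
  have hcont : Continuous fun y : Fin 2 → I =>
      hopfRotate (Circle.exp (-((y 1 : ℝ) * θ (y 0)))) (F (y 1, y 0)) :=
    continuous_hopfRotate.comp (by fun_prop : Continuous fun y : Fin 2 → I =>
      (Circle.exp (-((y 1 : ℝ) * θ (y 0))), F (y 1, y 0)))
  let L : Ω^ (Fin 2) S7 x₀ := ⟨⟨_, hcont⟩, by
    intro y hy
    rcases mem_boundary_fin_two.1 hy with hi | hi | hi | hi <;>
      simp [hi, hF0, hFl, hFr, hFt, hθ0, hθ1, hopfRotate_one, hopfRotate_rotate]⟩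
  obtain ⟨K⟩ := genLoop_S7_homotopic_const (by simp) L
  have hcomp := isOpenQuotientMap_hopfMap.continuous
  refine ⟨⟨⟨⟨fun p => hopfMap (K p), hcomp.comp K.continuous⟩, fun y => ?_, fun y => ?_⟩, ?_⟩⟩
  · have hy : y = ![y 0, y 1] := by
      ext i
      fin_cases i <;> rfl
    have h0 : K (0, y) = L.1 y := K.apply_zero y
    change hopfMap (K (0, y)) = f y
    rw [h0]
    refine (hopfMap_rotate _ _).trans ((hF _ _).trans (congrArg f hy.symm))
  · exact congrArg hopfMap (K.apply_one y)
  · intro t y hy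
    have h0 : K (t, y) = L.1 y := K.eq_fst t hy
    change hopfMap (K (t, y)) = f y
    rw [h0, L.2 y hy]
    exact (f.2 y hy).symm

theorem HopfDegree.transAt {x₀ : S7} {f g : Ω^ (Fin 2) CP3 (hopfMap x₀)} {n m : ℤ}
    (hf : HopfDegree x₀ f n) (hg : HopfDegree x₀ g m) :
    HopfDegree x₀ (GenLoop.transAt 0 f g) (n + m) := by
  obtain ⟨F, θ, hF, hF0, hFl, hFr, hFt, hθ0, hθ1⟩ := hf
  obtain ⟨G, η, hG, hG0, hGl, hGr, hGt, hη0, hη1⟩ := hg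
  obtain ⟨L, hL⟩ := exists_concat F G fun t => (hFr t).trans (hGl t).symm
  obtain ⟨ζ, hζ⟩ := exists_concat (θ.comp ⟨fun p : I × I => p.2, by fun_prop⟩)
    (η.comp ⟨fun p : I × I => p.2, by fun_prop⟩ + .const _ (n * (2 * Real.pi)))
    fun t => by simp [hθ1, hη0]
  have hπ : Circle.exp (n * (2 * Real.pi)) = 1 := Circle.exp_eq_one.2 ⟨n, rfl⟩
  refine ⟨L, ζ.comp ⟨fun s => (0, s), by fun_prop⟩, fun t s => ?_, fun s => ?_, fun t => ?_,
    fun t => ?_, fun s => ?_, ?_, ?_⟩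
  · rw [GenLoop.transAt, GenLoop.coe_copy]
    by_cases hs : (s : ℝ) ≤ 1 / 2
    · rw [hL, if_pos hs, hF]
      refine Eq.trans (congrArg f ?_)
        (if_pos (c := ((![s, t] : Fin 2 → I) 0 : ℝ) ≤ 1 / 2) hs).symm
      ext i
      fin_cases i <;> simp
    · rw [hL, if_neg hs, hG]
      refine Eq.trans (congrArg g ?_)
        (if_neg (c := ((![s, t] : Fin 2 → I) 0 : ℝ) ≤ 1 / 2) hs).symm
      ext i
      fin_cases i <;> simp
  · rw [hL]
    split_ifs
    exacts [hF0 _, hG0 _]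
  · simp [hL, hFl]
  · rw [hL, if_neg (by norm_num)]
    norm_num
    exact hGr t
  · simp only [hL, hζ, ContinuousMap.comp_apply, ContinuousMap.coe_mk]
    split_ifs
    · exact hFt _
    · simp [hGt, Circle.exp_add, hπ]
  · simp [hζ, hθ0]
  · simp only [ContinuousMap.comp_apply, ContinuousMap.coe_mk, hζ]
    rw [if_neg (by norm_num)]
    norm_num
    rw [hη1]
    ring

theorem exists_genLoop_hopfDegree (x₀ : S7) (n : ℤ) :
    ∃ f : Ω^ (Fin 2) CP3 (hopfMap x₀), HopfDegree x₀ f n := by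
  have hcont : Continuous fun y : Fin 1 → I =>
      hopfRotate (Circle.exp ((y 0 : ℝ) * (n * (2 * Real.pi)))) x₀ :=
    continuous_hopfRotate.comp (by fun_prop : Continuous fun y : Fin 1 → I =>
      (Circle.exp ((y 0 : ℝ) * (n * (2 * Real.pi))), x₀))
  have hπ : Circle.exp (n * (2 * Real.pi)) = 1 := Circle.exp_eq_one.2 ⟨n, rfl⟩
  let ℓ : Ω^ (Fin 1) S7 x₀ := ⟨⟨_, hcont⟩, by
    rintro y ⟨i, hi⟩
    rw [Subsingleton.elim i 0] at hi
    rcases hi with hi | hi <;> simp [hi, hopfRotate_one, hπ]⟩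
  obtain ⟨K⟩ := (genLoop_S7_homotopic_const (by simp) ℓ).symm
  have hK0 : ∀ y, K (0, y) = x₀ := fun y => K.apply_zero y
  have hKb : ∀ t y, y ∈ Cube.boundary (Fin 1) → K (t, y) = x₀ := fun t y hy => K.eq_fst t hy
  have hK1 : ∀ y, K (1, y) = hopfRotate (Circle.exp ((y 0 : ℝ) * (n * (2 * Real.pi)))) x₀ :=
    fun y => K.apply_one y
  let F : C(I × I, S7) := K.toContinuousMap.comp ⟨fun p => (p.1, fun _ => p.2), by fun_prop⟩
  have hFl : ∀ t, F (t, 0) = x₀ := fun t => hKb t _ ⟨0, Or.inl rfl⟩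
  have hFr : ∀ t, F (t, 1) = x₀ := fun t => hKb t _ ⟨0, Or.inr rfl⟩
  have hFt : ∀ s : I, F (1, s) = hopfRotate (Circle.exp ((s : ℝ) * (n * (2 * Real.pi)))) x₀ :=
    fun s => hK1 _
  have hF0 : ∀ s, F (0, s) = x₀ := fun s => hK0 _
  have hmk := isOpenQuotientMap_hopfMap.continuous
  refine ⟨⟨⟨fun y => hopfMap (F (y 1, y 0)), hmk.comp (by fun_prop)⟩, ?_⟩, F,
    ⟨fun s => (s : ℝ) * (n * (2 * Real.pi)), by fun_prop⟩, fun t s => rfl, hF0, hFl, hFr, hFt,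
    by simp, by simp⟩
  intro y hy
  rcases mem_boundary_fin_two.1 hy with hi | hi | hi | hi <;>
    simp [hi, hF0, hFl, hFr, hFt, hopfMap_rotate]

end

open Topology in
/-- The second homotopy group of `ℂP³` is infinite cyclic. -/
theorem cp3_pi2 (P : CP3) : Nonempty (HomotopyGroup (Fin 2) CP3 P ≃* Multiplicative ℤ) := by
  obtain ⟨x₀, rfl⟩ := isOpenQuotientMap_hopfMap.surjective P
  choose d hd using exists_hopfDegree x₀
  let φ : HomotopyGroup (Fin 2) CP3 (hopfMap x₀) → Multiplicative ℤ :=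
    Quotient.lift (fun f => Multiplicative.ofAdd (d f)) fun f g h =>
      congrArg Multiplicative.ofAdd ((hd f).eq_of_homotopic (hd g) h)
  have hφ : ∀ a b, φ (a * b) = φ a * φ b := by
    intro a b
    induction a using Quotient.inductionOn with | _ p
    induction b using Quotient.inductionOn with | _ q
    have h := HomotopyGroup.mul_spec (i := (0 : Fin 2)) (p := p) (q := q)
    refine (congrArg φ h).trans ?_
    rw [mul_comm]
    exact congrArg Multiplicative.ofAdd
      ((hd _).eq_of_homotopic ((hd q).transAt (hd p)) (GenLoop.Homotopic.refl _))
  refine ⟨MulEquiv.ofBijective (MonoidHom.mk' φ hφ) ⟨?_, fun n => ?_⟩⟩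
  · rw [injective_iff_map_eq_one]
    intro a ha
    induction a using Quotient.inductionOn with | _ f
    have h0 : d f = 0 := ha
    exact Quotient.sound (HopfDegree.homotopic_const (h0 ▸ hd f))
  · obtain ⟨f, hf⟩ := exists_genLoop_hopfDegree x₀ n.toAdd
    exact ⟨Quotient.mk _ f, congrArg Multiplicative.ofAdd
      ((hd f).eq_of_homotopic hf (GenLoop.Homotopic.refl _))⟩
end

section
/- Let $S^7$ denote the unit sphere in the Euclidean space $\mathbb{C}^4$ (i.e. `Metric.sphere 0 1` in `EuclideanSpace ℂ (Fin 4)`), and let $\mathbb{CP}^3$ denote the quotient of $S^7$ by the action of the group of unit complex numbers acting by scalar multiplication, equipped with the quotient topology. Then the homotopy groups $\pi_i(\mathbb{CP}^3)$ are trivial for $i = 3, 4, 5$ (at any basepoint). -/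
open scoped unitInterval Topology RealInnerProductSpace

/-- Radial projection of a nowhere vanishing map to the unit sphere. -/
noncomputable def ContinuousMap.normalize {X E : Type*} [TopologicalSpace X]
    [NormedAddCommGroup E] [NormedSpace ℝ E] (f : C(X, E))
    (hf : ∀ x, f x ≠ 0) : C(X, Metric.sphere (0 : E) 1) where
  toFun x := ⟨‖f x‖⁻¹ • f x, by simp [norm_smul, hf x]⟩
  continuous_toFun := by
    refine Continuous.subtype_mk (Continuous.smul (Continuous.inv₀ ?_ ?_) ?_) _
    · fun_prop
    · simpa using hf
    · fun_prop

section Sphere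

variable {E : Type*} [NormedAddCommGroup E] [InnerProductSpace ℝ E]

/-- A map to the sphere missing a point contracts to any other point, relative to the set where it
already takes that value. -/
theorem ContinuousMap.homotopicRel_const_of_forall_ne {X : Type*} [TopologicalSpace X]
    (F : C(X, Metric.sphere (0 : E) 1)) {v e : Metric.sphere (0 : E) 1} (hF : ∀ x, F x ≠ v)
    (hev : e ≠ v) {S : Set X} (hS : ∀ x ∈ S, F x = e) :
    F.HomotopicRel (ContinuousMap.const X e) S := by
  have hv : ‖(v : E)‖ = 1 := norm_eq_of_mem_sphere v
  have hcont : Continuous fun x => stereographic hv (F x) := by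
    refine (stereographic hv).continuousOn.comp_continuous F.continuous fun x => ?_
    simpa using hF x
  have hinv : Continuous (stereographic hv).symm := continuous_stereoInvFun hv
  have hl : ∀ y : Metric.sphere (0 : E) 1, y ≠ v →
      (stereographic hv).symm (stereographic hv y) = y := fun y hy =>
    (stereographic hv).left_inv (by simpa using hy)
  refine ⟨⟨⟨⟨fun p => (stereographic hv).symm ((1 - (p.1 : ℝ)) • stereographic hv (F p.2) +
    (p.1 : ℝ) • stereographic hv e), ?_⟩, fun x => ?_, fun x => ?_⟩, fun t x hx => ?_⟩⟩
  · have := hcont.comp (continuous_snd (X := I) (Y := X))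
    have hfst : Continuous fun p : I × X => (p.1 : ℝ) := by fun_prop
    exact hinv.comp (((continuous_const.sub hfst).smul this).add (hfst.smul continuous_const))
  · simp [hl _ (hF x)]
  · simp [hl _ hev]
  · simp only [ContinuousMap.coe_mk]
    rw [hS x hx, ← add_smul]
    simp [hl _ hev]

/-- A continuous map from a cube to a space whose dimension is larger by at least two is uniformly
close to a map `G` such that some vector near `w` lies on no line through the origin meeting the
image of `G`. -/
theorem exists_approx_forall_smul_ne {N : Type*} [Fintype N] [FiniteDimensional ℝ E]
    (hN : Fintype.card N + 1 < Module.finrank ℝ E) (F : C(N → I, E)) (w : E) {ε δ : ℝ}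
    (hε : 0 < ε) (hδ : 0 < δ) :
    ∃ G : C(N → I, E), (∀ x, ‖G x - F x‖ < ε) ∧
      ∃ v : E, ‖v - w‖ < δ ∧ ∀ (r : ℝ) x, r • G x ≠ v := by
  let clamp : (N → ℝ) → (N → I) := fun x n => Set.projIcc 0 1 zero_le_one (x n)
  have hclamp : Continuous clamp := by
    refine continuous_pi fun n => continuous_projIcc.comp (continuous_apply n)
  obtain ⟨g, hg, hgF, -⟩ := (F.continuous.comp hclamp).exists_contDiff_approx (n := 1)
    (ε := fun _ => ε) continuous_const fun _ => hε
  have hdense : Dense (Set.range fun p : ℝ × (N → ℝ) => p.1 • g p.2)ᶜ := by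
    refine ContDiff.dense_compl_range_of_finrank_lt_finrank ?_ ?_
    · exact contDiff_fst.smul ((by simpa using hg : ContDiff ℝ 1 g).comp contDiff_snd)
    · simpa [Nat.add_comm] using hN
  obtain ⟨v, hv, hvw⟩ := hdense.exists_dist_lt w hδ
  refine ⟨⟨fun x => g fun n => x n, hg.continuous.comp (by fun_prop)⟩, fun x => ?_, v, ?_, ?_⟩
  · have := hgF fun n => x n
    rw [dist_eq_norm] at this
    have hx : clamp (fun n => (x n : ℝ)) = x := by
      ext n; simp [clamp]
    simpa [hx] using this
  · rwa [← dist_eq_norm, dist_comm]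
  · intro r x h
    exact hv ⟨(r, fun n => x n), h⟩

/-- The sphere in `E` has trivial homotopy groups below its dimension. -/
theorem GenLoop.homotopic_const_of_card_lt_finrank {N : Type*} [Fintype N]
    [FiniteDimensional ℝ E] (hN : Fintype.card N + 1 < Module.finrank ℝ E)
    {e : Metric.sphere (0 : E) 1} (F : GenLoop N (Metric.sphere (0 : E) 1) e) :
    GenLoop.Homotopic F GenLoop.const := by
  let F₀ : C(N → I, E) := ⟨fun x => (F x : E), by fun_prop⟩
  have hF₀ : ∀ x, ‖F₀ x‖ = 1 := fun x => norm_eq_of_mem_sphere (F x)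
  have he : ‖(e : E)‖ = 1 := norm_eq_of_mem_sphere e
  obtain ⟨G, hG, v, hve, hv⟩ := exists_approx_forall_smul_ne hN F₀ (-(e : E))
    (show (0 : ℝ) < 1 / 4 by norm_num) (show (0 : ℝ) < 1 by norm_num)
  have hv0 : v ≠ 0 := fun h => hv 0 0 (by simp [h])
  let l : (N → I) → ℝ := fun x => min 1 (2 * ‖F₀ x - e‖)
  have hl : Continuous l := by fun_prop
  have hl0 : ∀ x, 0 ≤ l x := fun x => le_min zero_le_one (by positivity)
  have hl1 : ∀ x, l x ≤ 1 := fun x => min_le_left _ _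
  let H : C(I × (N → I), E) :=
    ⟨fun p => F₀ p.2 + ((p.1 : ℝ) * l p.2) • (G p.2 - F₀ p.2), by fun_prop⟩
  have hH : ∀ p, ‖H p - F₀ p.2‖ < 1 / 4 := by
    intro p
    have h1 : (p.1 : ℝ) * l p.2 ≤ 1 := mul_le_one₀ p.1.2.2 (hl0 _) (hl1 _)
    have h0 : 0 ≤ (p.1 : ℝ) * l p.2 := mul_nonneg p.1.2.1 (hl0 _)
    simp only [H, ContinuousMap.coe_mk, add_sub_cancel_left, norm_smul, Real.norm_eq_abs,
      abs_of_nonneg h0]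
    nlinarith [hG p.2, norm_nonneg (G p.2 - F₀ p.2)]
  have hH0 : ∀ p, H p ≠ 0 := by
    intro p hp
    have := hH p
    rw [hp, zero_sub, norm_neg, hF₀] at this
    norm_num at this
  let K := H.normalize hH0
  have hKb : ∀ t, ∀ x ∈ Cube.boundary N, K (t, x) = e := by
    intro t x hx
    have hFx : F₀ x = e := congrArg Subtype.val (F.2 x hx)
    have : H (t, x) = e := by simp [H, l, hFx]
    ext1
    simp [K, ContinuousMap.normalize, this]
  let F₁ : C(N → I, Metric.sphere (0 : E) 1) := K.comp ⟨fun x => (1, x), by fun_prop⟩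
  have hF₁ : F.1.HomotopicRel F₁ (Cube.boundary N) := by
    refine ⟨⟨⟨K, fun x => ?_, fun x => rfl⟩, fun t x hx => ?_⟩⟩
    · ext1
      have : H (0, x) = F x := by simp [H, F₀]
      simp [K, ContinuousMap.normalize, this]
    · exact (hKb t x hx).trans (F.2 x hx).symm
  have hvn : ‖v‖ ≠ 0 := norm_ne_zero_iff.2 hv0
  have hev : ⟪v, (e : E)⟫ < 0 := by
    have h := norm_sub_sq_real v (-(e : E))
    rw [inner_neg_right, norm_neg, he] at h
    nlinarith [norm_nonneg (v - -(e : E)), norm_nonneg v, sq_nonneg ‖v‖]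
  have hpos : ∀ u : E, ‖u - e‖ < 1 → ∀ c : ℝ, 0 ≤ c → u ≠ c • v := by
    rintro u hu c hc rfl
    have h := norm_sub_sq_real (c • v) (e : E)
    rw [inner_smul_left, he] at h
    simp only [conj_trivial] at h
    nlinarith [norm_nonneg (c • v - (e : E)), sq_nonneg ‖c • v‖, mul_nonneg hc (neg_nonneg.2 hev.le)]
  let v₁ : Metric.sphere (0 : E) 1 := ⟨‖v‖⁻¹ • v, by simp [norm_smul, hvn]⟩
  have hmiss : ∀ x, F₁ x ≠ v₁ := by
    intro x hx
    have h2 : ‖H (1, x)‖⁻¹ • H (1, x) = ‖v‖⁻¹ • v := congrArg Subtype.val hx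
    have hn : ‖H (1, x)‖ ≠ 0 := norm_ne_zero_iff.2 (hH0 _)
    have h3 : H (1, x) = (‖H (1, x)‖ * ‖v‖⁻¹) • v := by
      rw [mul_smul, ← h2, smul_smul, mul_inv_cancel₀ hn, one_smul]
    rcases le_or_gt 1 (2 * ‖F₀ x - e‖) with hx1 | hx1
    · have h4 : H (1, x) = G x := by simp [H, l, min_eq_left hx1]
      refine hv (‖v‖ * ‖H (1, x)‖⁻¹) x ?_
      rw [← h4, mul_smul, h2, smul_smul, mul_inv_cancel₀ hvn, one_smul]
    · refine hpos _ ?_ _ (by positivity) h3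
      have h5 := norm_sub_le_norm_sub_add_norm_sub (H (1, x)) (F₀ x) (e : E)
      have h6 : ‖H (1, x) - F₀ x‖ < 1 / 4 := hH (1, x)
      linarith
  have hne : e ≠ v₁ := by
    intro h
    refine hpos e (by simp) ‖v‖⁻¹ (by positivity) ?_
    conv_lhs => rw [h]
  exact hF₁.trans (F₁.homotopicRel_const_of_forall_ne hmiss hne fun x hx => hKb 1 x hx)

end Sphere

namespace CP3

/-- The Hopf projection. -/
noncomputable def hopf : C(S7, CP3) := ⟨Quotient.mk hopfSetoid, continuous_quot_mk⟩

theorem hopf_eq_hopf {x y : S7} :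
    hopf x = hopf y ↔ ∃ z : Circle, z • (x : EuclideanSpace ℂ (Fin 4)) = y :=
  Quotient.eq (r := hopfSetoid)

theorem exists_hopf_eq (p : CP3) : ∃ x, hopf x = p := Quotient.exists_rep p

/-- The orthogonal projection of `ℂ⁴` to a complex line. -/
noncomputable def lineProj : CP3 → EuclideanSpace ℂ (Fin 4) →L[ℂ] EuclideanSpace ℂ (Fin 4) :=
  Quotient.lift (s := hopfSetoid) (fun x : S7 => InnerProductSpace.rankOne ℂ
    (x : EuclideanSpace ℂ (Fin 4)) (x : EuclideanSpace ℂ (Fin 4))) <| by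
  rintro x y ⟨z, hz⟩
  ext1 w
  have h : (starRingEnd ℂ) (z : ℂ) * z = 1 := by
    rw [mul_comm, Complex.mul_conj, Circle.normSq_coe, Complex.ofReal_one]
  simp only [← hz, InnerProductSpace.rankOne_apply, Circle.smul_def, inner_smul_left, smul_smul]
  rw [mul_right_comm, h, one_mul]

theorem continuous_lineProj : Continuous lineProj :=
  Continuous.quotient_lift
    (((ContinuousLinearMap.smulRightL ℂ (EuclideanSpace ℂ (Fin 4))
      (EuclideanSpace ℂ (Fin 4))).continuous.comp ((innerSL ℂ).continuous.comp
        continuous_subtype_val)).clm_apply continuous_subtype_val) _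

theorem lineProj_hopf (x : S7) (w : EuclideanSpace ℂ (Fin 4)) :
    lineProj (hopf x) w = inner ℂ (x : EuclideanSpace ℂ (Fin 4)) w • x := rfl

theorem lineProj_hopf_self (x : S7) : lineProj (hopf x) x = x := by
  rw [lineProj_hopf, inner_self_eq_norm_sq_to_K, norm_eq_of_mem_sphere x]
  simp

/-- A lift to `S⁷` of a map to `ℂP³` can be transported to a nearby map, without changing it where
the two maps agree. -/
theorem exists_lift_of_near {A : Type*} [TopologicalSpace A] (F : C(A, S7)) (g : C(A, CP3))
    (h : ∀ a, ‖lineProj (hopf (F a)) - lineProj (g a)‖ < 1) :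
    ∃ F' : C(A, S7), (∀ a, hopf (F' a) = g a) ∧ ∀ a, g a = hopf (F a) → F' a = F a := by
  let M : C(A, EuclideanSpace ℂ (Fin 4)) :=
    ⟨fun a => lineProj (g a) (F a), by
      have := continuous_lineProj.comp g.continuous
      exact this.clm_apply (by fun_prop)⟩
  have hM : ∀ a, M a ≠ 0 := by
    intro a ha
    have h1 : (lineProj (hopf (F a)) - lineProj (g a)) (F a) = F a := by
      rw [sub_apply, lineProj_hopf_self]
      exact (congrArg _ ha).trans (sub_zero _)
    have h2 := (lineProj (hopf (F a)) - lineProj (g a)).le_opNorm (F a)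
    rw [h1, norm_eq_of_mem_sphere (F a), mul_one] at h2
    exact (h a).not_ge h2
  refine ⟨M.normalize hM, fun a => ?_, fun a ha => ?_⟩
  · obtain ⟨y, hy⟩ := exists_hopf_eq (g a)
    rw [← hy, eq_comm, hopf_eq_hopf]
    have hMa : M a = inner ℂ (y : EuclideanSpace ℂ (Fin 4)) (F a : EuclideanSpace ℂ (Fin 4)) •
        (y : EuclideanSpace ℂ (Fin 4)) := by
      rw [← lineProj_hopf, hy]; rfl
    set c := inner ℂ (y : EuclideanSpace ℂ (Fin 4)) (F a : EuclideanSpace ℂ (Fin 4))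
    have hc : c ≠ 0 := fun h0 => hM a (by rw [hMa, h0, zero_smul])
    have hn : ‖M a‖ = ‖c‖ := by rw [hMa, norm_smul, norm_eq_of_mem_sphere y, mul_one]
    refine ⟨⟨(‖c‖ : ℂ)⁻¹ * c, ?_⟩, ?_⟩
    · simp [Submonoid.unitSphere, hc]
    · change ((‖c‖ : ℂ)⁻¹ * c) • (y : EuclideanSpace ℂ (Fin 4)) = ‖M a‖⁻¹ • M a
      rw [mul_smul, ← hMa, hn, ← Complex.ofReal_inv, Complex.coe_smul]
  · have hMa : M a = F a := by
      change lineProj (g a) (F a) = F a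
      rw [ha, lineProj_hopf_self]
    ext1
    change ‖M a‖⁻¹ • M a = F a
    rw [hMa, norm_eq_of_mem_sphere (F a), inv_one, one_smul]

/-- Homotopy lifting for the Hopf projection on a cube, where constant paths lift to constant
paths. -/
theorem exists_lift {N : Type*} [Fintype N] [DecidableEq N] (f : C(N → I, CP3)) (i : N) (e : S7)
    (hf : ∀ x, x i = 0 → f x = hopf e) :
    ∃ F : C(N → I, S7), (∀ x, hopf (F x) = f x) ∧
      ∀ x, (∀ s ≤ x i, f (Function.update x i s) = hopf e) → F x = e := by
  have hu := CompactSpace.uniformContinuous_of_continuous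
    (continuous_lineProj.comp f.continuous)
  obtain ⟨δ, hδ, hfδ⟩ := Metric.uniformContinuous_iff.1 hu 1 one_pos
  let s : ℕ → I := fun k => Set.projIcc 0 1 zero_le_one (k * (δ / 2))
  have hs : ∀ k, dist (s k) (s (k + 1)) < δ := by
    intro k
    refine ((LipschitzWith.projIcc zero_le_one).dist_le_mul _ _).trans_lt ?_
    rw [Real.dist_eq]
    push_cast
    rw [show (k : ℝ) * (δ / 2) - (k + 1) * (δ / 2) = -(δ / 2) by ring, abs_neg,
      abs_of_pos (by positivity)]
    linarith
  let c : ℕ → C(N → I, N → I) := fun k =>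
    ⟨fun x => Function.update x i (min (x i) (s k)), by fun_prop⟩
  have hc : ∀ k x, dist (c k x) (c (k + 1) x) < δ := by
    intro k x
    refine ((dist_pi_le_iff dist_nonneg).2 fun j => ?_).trans_lt (hs k)
    by_cases hj : j = i
    · subst hj
      simp only [c, ContinuousMap.coe_mk, Function.update_self, Subtype.dist_eq, Real.dist_eq]
      have hm : ∀ a b : I, ((min a b : I) : ℝ) = min (a : ℝ) b := fun a b =>
        (Subtype.mono_coe _).map_min
      rw [hm, hm]
      refine (abs_min_sub_min_le_max _ _ _ _).trans ?_
      simp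
    · simp [c, hj]
  have key : ∀ k, ∃ F : C(N → I, S7), (∀ x, hopf (F x) = f (c k x)) ∧
      ∀ x, (∀ s ≤ x i, f (Function.update x i s) = hopf e) → F x = e := by
    intro k
    induction k with
    | zero =>
      refine ⟨.const _ e, fun x => (hf _ ?_).symm, fun x _ => rfl⟩
      simp [c, s]
    | succ k ih =>
      obtain ⟨F, hF, hFe⟩ := ih
      obtain ⟨F', hF', hFF'⟩ := exists_lift_of_near F (f.comp (c (k + 1))) fun x => by
        rw [hF, ← dist_eq_norm]
        exact hfδ (hc k x)
      refine ⟨F', hF', fun x hx => ?_⟩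
      rw [← hFe x hx]
      refine hFF' x ?_
      rw [hFe x hx]
      exact hx _ (min_le_left _ _)
  obtain ⟨k, hk⟩ := exists_nat_ge (2 / δ)
  obtain ⟨F, hF, hFe⟩ := key k
  refine ⟨F, fun x => ?_, hFe⟩
  have hsk : s k = 1 := by
    refine Set.projIcc_of_right_le _ ?_
    rw [div_le_iff₀ hδ] at hk
    linarith
  have hmin : min (x i) 1 = x i := min_eq_left unitInterval.le_one'
  rw [hF]
  simp [c, hsk, hmin]

end CP3

/-- A map from a cube of dimension at least three to the circle that equals one on all faces in
directions other than `i` has a logarithm vanishing on those faces. -/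
theorem exists_circle_log {N : Type*} [Fintype N] [DecidableEq N] (g : C(N → I, Circle))
    {i j k : N} (hji : j ≠ i) (hki : k ≠ i) (hkj : k ≠ j)
    (hg : ∀ x l, l ≠ i → x l = 0 ∨ x l = 1 → g x = 1) :
    ∃ φ : C(N → I, ℝ), (∀ x, Circle.exp (φ x) = g x) ∧
      ∀ x l, l ≠ i → x l = 0 ∨ x l = 1 → φ x = 0 := by
  let H : C(I × (N → I), Circle) :=
    ⟨fun p => g (Function.update p.2 j p.1), by fun_prop⟩
  have H0 : ∀ x, H (0, x) = Circle.exp ((0 : C(N → I, ℝ)) x) := by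
    intro x
    rw [ContinuousMap.zero_apply, Circle.exp_zero]
    exact hg _ j hji (by simp)
  let Φ := Circle.isCoveringMap_exp.liftHomotopy H 0 H0
  have hΦ : ∀ p, Circle.exp (Φ p) = H p :=
    congrFun (Circle.isCoveringMap_exp.liftHomotopy_lifts H 0 H0)
  have hΦ0 : ∀ x, Φ (0, x) = 0 := Circle.isCoveringMap_exp.liftHomotopy_zero H 0 H0
  have hΦc : ∀ x l, l ≠ i → l ≠ j → x l = 0 ∨ x l = 1 → ∀ t, Φ (t, x) = 0 := by
    intro x l hli hlj hx t
    have h1 : (fun t => Φ (t, x)) = fun _ => Φ (0, x) := by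
      refine Circle.isCoveringMap_exp.eq_of_comp_eq (by fun_prop) (by fun_prop) ?_ 0 rfl
      ext1 t
      simp only [Function.comp_apply, hΦ, H, ContinuousMap.coe_mk]
      rw [hg _ l hli (by simpa [hlj] using hx), hg _ l hli (by simpa [hlj] using hx)]
    rw [congrFun h1 t, hΦ0]
  have hΦ1 : ∀ x, Φ (1, x) = 0 := by
    intro x
    have h1 : (fun y : N → I => Φ (1, y)) = fun _ => Φ (1, fun _ => 0) := by
      refine Circle.isCoveringMap_exp.eq_of_comp_eq (by fun_prop) (by fun_prop) ?_ (fun _ => 0) rfl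
      ext1 y
      simp only [Function.comp_apply, hΦ, H, ContinuousMap.coe_mk]
      rw [hg _ j hji (by simp), hg _ j hji (by simp)]
    rw [congrFun h1 x]
    exact hΦc _ k hki hkj (Or.inl rfl) 1
  refine ⟨⟨fun x => Φ (x j, x), by fun_prop⟩, fun x => ?_, fun x l hl hx => ?_⟩
  · exact (hΦ (x j, x)).trans (by simp [H])
  · by_cases hlj : l = j
    · subst hlj
      rcases hx with hx | hx
      · simp [hx, hΦ0]
      · simp [hx, hΦ1]
    · exact hΦc x l hl hlj hx _

namespace CP3

/-- In dimension at least three, generalized loops in `ℂP³` lift to generalized loops in `S⁷`. -/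
theorem exists_genLoop_lift {N : Type*} [Fintype N] [DecidableEq N] {i j k : N} (hji : j ≠ i)
    (hki : k ≠ i) (hkj : k ≠ j) (e : S7) (f : GenLoop N CP3 (hopf e)) :
    ∃ F : GenLoop N S7 e, ∀ x, hopf (F x) = f x := by
  obtain ⟨F, hF, hFe⟩ := exists_lift f.1 i e fun x hx => f.2 x ⟨i, Or.inl hx⟩
  have hFl : ∀ x l, l ≠ i → x l = 0 ∨ x l = 1 → F x = e := fun x l hl hx =>
    hFe x fun s _ => f.2 _ ⟨l, by simpa [hl] using hx⟩
  have hF0 : ∀ x, x i = 0 → F x = e := fun x hx => by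
    refine hFe x fun s hs => f.2 _ ⟨i, Or.inl ?_⟩
    rw [Function.update_self]
    exact le_antisymm (hs.trans hx.le) s.2.1
  have hz : ∀ x, ∃ z : Circle, z • (e : EuclideanSpace ℂ (Fin 4)) = F (Function.update x i 1) := by
    intro x
    rw [← hopf_eq_hopf, hF]
    exact (f.2 _ ⟨i, by simp⟩).symm
  choose z hze using hz
  have hzi : ∀ x, (z x : ℂ) = inner ℂ (e : EuclideanSpace ℂ (Fin 4))
      (F (Function.update x i 1) : EuclideanSpace ℂ (Fin 4)) := by
    intro x
    rw [← hze, Circle.smul_def, inner_smul_right, inner_self_eq_norm_sq_to_K,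
      norm_eq_of_mem_sphere e]
    simp
  have hzc : Continuous z := by
    have hcoe : Topology.IsInducing fun w : Circle => (w : ℂ) := ⟨rfl⟩
    rw [hcoe.continuous_iff]
    have : Continuous fun x => inner ℂ (e : EuclideanSpace ℂ (Fin 4))
      (F (Function.update x i 1) : EuclideanSpace ℂ (Fin 4)) := by fun_prop
    exact this.congr fun x => (hzi x).symm
  obtain ⟨φ, hφ, hφ0⟩ := exists_circle_log ⟨z, hzc⟩ hji hki hkj fun x l hl hx => by
    ext1
    change (z x : ℂ) = _
    rw [hzi, hFl _ l hl (by simpa [hl] using hx), inner_self_eq_norm_sq_to_K,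
      norm_eq_of_mem_sphere e]
    simp
  let u : (N → I) → Circle := fun x => Circle.exp (-(x i * φ x))
  have hu : Continuous u := by fun_prop
  have hmem : ∀ x, u x • (F x : EuclideanSpace ℂ (Fin 4)) ∈
      Metric.sphere (0 : EuclideanSpace ℂ (Fin 4)) 1 := by
    intro x
    rw [mem_sphere_zero_iff_norm, Circle.smul_def, norm_smul, Circle.norm_coe, one_mul,
      norm_eq_of_mem_sphere (F x)]
  refine ⟨⟨⟨fun x => ⟨u x • (F x : EuclideanSpace ℂ (Fin 4)), hmem x⟩, ?_⟩, ?_⟩, ?_⟩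
  · exact Continuous.subtype_mk (hu.smul (by fun_prop)) _
  · rintro x ⟨l, hl⟩
    ext1
    change u x • (F x : EuclideanSpace ℂ (Fin 4)) = e
    by_cases hli : l = i
    · subst hli
      rcases hl with hl | hl
      · simp [u, hl, hF0 x hl]
      · have h1 := hze x
        rw [← hl, Function.update_eq_self] at h1
        have h2 : Circle.exp (φ x) = z x := hφ x
        rw [← h1, smul_smul]
        simp [u, hl, h2, Circle.exp_neg]
    · simp [u, hφ0 x l hli hl, hFl x l hli hl]
  · intro x
    refine Eq.trans ?_ (hF x)
    exact (hopf_eq_hopf.2 ⟨u x, rfl⟩).symm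

end CP3

/-- The homotopy groups `π_i(ℂP³)` are trivial for `i = 3, 4, 5`. -/
theorem cp3_pi_3_4_5 (i : ℕ) (hi : i = 3 ∨ i = 4 ∨ i = 5) (P : CP3) :
    Nonempty (HomotopyGroup (Fin i) CP3 P) ∧ Subsingleton (HomotopyGroup (Fin i) CP3 P) := by
  refine ⟨⟨default⟩, ?_⟩
  obtain ⟨e, rfl⟩ := CP3.exists_hopf_eq P
  let : InnerProductSpace ℝ (EuclideanSpace ℂ (Fin 4)) := InnerProductSpace.complexToReal
  have hdim : Fintype.card (Fin i) + 1 < Module.finrank ℝ (EuclideanSpace ℂ (Fin 4)) := by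
    rw [finrank_real_of_complex, finrank_euclideanSpace_fin, Fintype.card_fin]
    omega
  have key : ∀ f : GenLoop (Fin i) CP3 (CP3.hopf e), GenLoop.Homotopic f GenLoop.const := by
    intro f
    obtain ⟨F, hF⟩ := CP3.exists_genLoop_lift (i := (⟨0, by omega⟩ : Fin i))
      (j := ⟨1, by omega⟩) (k := ⟨2, by omega⟩) (by simp) (by simp) (by simp) e f
    have hf : f.1 = CP3.hopf.comp F.1 := ContinuousMap.ext fun x => (hF x).symm
    have h := (GenLoop.homotopic_const_of_card_lt_finrank hdim F).comp_continuousMap CP3.hopf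
    rwa [← hf] at h
  refine ⟨fun a b => ?_⟩
  induction a using Quotient.inductionOn with | _ f =>
  induction b using Quotient.inductionOn with | _ g =>
  exact Quotient.sound ((key f).trans (key g).symm)
end

section
/- Let $S^7$ denote the unit sphere in the Euclidean space $\mathbb{C}^4$ (i.e. `Metric.sphere 0 1` in `EuclideanSpace ℂ (Fin 4)`). Then $S^7$ is simply connected and its homotopy groups $\pi_i(S^7)$ are trivial for all $1 \le i \le 6$ (at any basepoint). -/
open Metric Module Set

open scoped unitInterval

section Sphere

variable {E : Type*} [NormedAddCommGroup E] [InnerProductSpace ℝ E]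

/-- The radial projection of a nowhere vanishing continuous map onto the unit sphere. -/
noncomputable def ContinuousMap.normalizeToSphere {X : Type*} [TopologicalSpace X] (f : C(X, E))
    (hf : ∀ x, f x ≠ 0) : C(X, sphere (0 : E) 1) where
  toFun x := ⟨‖f x‖⁻¹ • f x,
    mem_sphere_zero_iff_norm.2 (norm_smul_inv_norm (𝕜 := ℝ) (hf x))⟩
  continuous_toFun :=
    ((f.continuous.norm.inv₀ fun x => norm_ne_zero_iff.2 (hf x)).smul f.continuous).subtype_mk
      fun x => mem_sphere_zero_iff_norm.2 (norm_smul_inv_norm (𝕜 := ℝ) (hf x))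

/-- If `g` is uniformly within distance less than `1` of a sphere-valued map `f`, then the radial
projection of `g` is homotopic to `f` relative to any set on which `f` and `g` agree. -/
theorem ContinuousMap.homotopicRel_normalizeToSphere {X : Type*} [TopologicalSpace X]
    (f : C(X, sphere (0 : E) 1)) (g : C(X, E)) (hg : ∀ x, g x ≠ 0)
    (hfg : ∀ x, ‖g x - f x‖ < 1) {S : Set X} (hS : ∀ x ∈ S, g x = f x) :
    f.HomotopicRel (g.normalizeToSphere hg) S := by
  let F : C(I × X, E) := ⟨fun p => (f p.2 : E) + (p.1 : ℝ) • (g p.2 - f p.2), by fun_prop⟩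
  have hF : ∀ p, F p ≠ 0 := by
    rintro ⟨t, x⟩ h
    have h1 : (f x : E) = -((t : ℝ) • (g x - f x)) := eq_neg_of_add_eq_zero_left h
    have h2 : ‖(f x : E)‖ = (t : ℝ) * ‖g x - f x‖ := by
      rw [h1, norm_neg, norm_smul, Real.norm_of_nonneg t.2.1, ← h1]
    rw [norm_eq_of_mem_sphere] at h2
    nlinarith [hfg x, t.2.1, t.2.2, norm_nonneg (g x - f x)]
  refine ⟨⟨⟨F.normalizeToSphere hF, fun x => ?_, fun x => ?_⟩, fun t x hx => ?_⟩⟩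
  · ext1
    simp [normalizeToSphere, F]
  · ext1
    simp [normalizeToSphere, F, -smul_add]
  · ext1
    simp [normalizeToSphere, F, hS x hx]

/-- A map to the unit sphere that misses a point is homotopic to a constant map relative to any
set on which it takes that constant value. -/
theorem ContinuousMap.homotopicRel_const_of_forall_ne_s7 {X : Type*} [TopologicalSpace X]
    (f : C(X, sphere (0 : E) 1)) {p x₀ : sphere (0 : E) 1} (hf : ∀ x, f x ≠ p) (hx₀ : x₀ ≠ p)
    {S : Set X} (hS : ∀ x ∈ S, f x = x₀) :
    f.HomotopicRel (ContinuousMap.const X x₀) S := by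
  let φ := stereographic (norm_eq_of_mem_sphere p)
  have hsrc : ∀ {y : sphere (0 : E) 1}, y ≠ p → y ∈ φ.source := fun hy => by
    rw [stereographic_source]; exact hy
  have hφf : Continuous fun x => φ (f x) :=
    φ.continuousOn.comp_continuous f.continuous fun x => hsrc (hf x)
  have hsymm : Continuous φ.symm :=
    (isOpenEmbedding_stereographic_symm (norm_eq_of_mem_sphere p)).continuous
  refine ⟨⟨⟨⟨fun q => φ.symm (AffineMap.lineMap (φ (f q.2)) (φ x₀) (q.1 : ℝ)), ?_⟩,
    fun x => ?_, fun x => ?_⟩, fun t x hx => ?_⟩⟩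
  · simp only [AffineMap.lineMap_apply_module]
    have hφf' : Continuous fun q : I × X => φ (f q.2) := hφf.comp continuous_snd
    have ht : Continuous fun q : I × X => (q.1 : ℝ) := by fun_prop
    exact hsymm.comp (((continuous_const.sub ht).smul hφf').add (ht.smul continuous_const))
  · simpa using φ.left_inv (hsrc (hf x))
  · simpa using φ.left_inv (hsrc hx₀)
  · simpa [hS x hx] using φ.left_inv (hsrc hx₀)

variable [FiniteDimensional ℝ E]

/-- A `C¹` map from a space of dimension at most `dim E - 2` misses the open ray through some
unit vector. -/
theorem ContDiff.exists_mem_sphere_forall_smul_ne {V : Type*} [NormedAddCommGroup V]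
    [NormedSpace ℝ V] [FiniteDimensional ℝ V] {g : V → E} (hg : ContDiff ℝ 1 g)
    (h : finrank ℝ V + 1 < finrank ℝ E) :
    ∃ p ∈ sphere (0 : E) 1, ∀ y (r : ℝ), r • g y ≠ p := by
  have hcone : ContDiff ℝ 1 fun q : ℝ × V => q.1 • g q.2 :=
    contDiff_fst.smul (hg.comp contDiff_snd)
  obtain ⟨q, hq⟩ := (hcone.dense_compl_range_of_finrank_lt_finrank
    (by rw [finrank_prod, finrank_self]; omega)).nonempty
  have hq0 : q ≠ 0 := by
    rintro rfl
    exact hq ⟨(0, 0), by simp⟩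
  refine ⟨‖q‖⁻¹ • q, by simp [norm_smul, hq0], fun y r hr => hq ⟨(‖q‖ * r, y), ?_⟩⟩
  simp [mul_smul, hr, hq0]

/-- Generalized loops in the unit sphere of `E`, of positive dimension less than the dimension of
the sphere, are null-homotopic. -/
theorem GenLoop.homotopic_const_sphere {N : Type*} [Fintype N] [Nonempty N]
    (hN : Fintype.card N + 1 < finrank ℝ E) {x₀ : sphere (0 : E) 1}
    (f : GenLoop N (sphere (0 : E) 1) x₀) : GenLoop.Homotopic f GenLoop.const := by
  let proj : (N → ℝ) → N → I := fun y i => projIcc 0 1 zero_le_one (y i)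
  have hproj : Continuous proj := by fun_prop
  have hh : Continuous fun y => (f (proj y) : E) - x₀ :=
    (continuous_subtype_val.comp (f.1.continuous.comp hproj)).sub continuous_const
  obtain ⟨u, hu, hdist, hsupp⟩ := hh.exists_contDiff_approx 1
    (ε := fun _ => (1 : ℝ)) continuous_const fun _ => one_pos
  let val : (N → I) → N → ℝ := fun y i => y i
  have hval : ∀ y, proj (val y) = y := fun y => funext fun i => projIcc_val _ _
  let g : C(N → I, E) := ⟨fun y => x₀ + u (val y), by
    have := hu.continuous
    fun_prop⟩
  have hgf : ∀ y, ‖g y - f.1 y‖ < 1 := fun y => by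
    have h := hdist (val y)
    rw [dist_eq_norm, hval] at h
    rwa [sub_sub_eq_add_sub, add_comm (u (val y))] at h
  have hg0 : ∀ y, g y ≠ 0 := fun y h => by
    have h' := hgf y
    rw [h, zero_sub, norm_neg, norm_eq_of_mem_sphere] at h'
    exact lt_irrefl _ h'
  have hgx₀ : ∀ y ∈ Cube.boundary N, g y = x₀ := fun y hy => by
    have hz : u (val y) = 0 := by
      by_contra hne
      exact hsupp hne (by simp [hval, GenLoop.boundary f y hy])
    change (x₀ : E) + u (val y) = x₀
    rw [hz, add_zero]
  have hbdry : ∀ y ∈ Cube.boundary N, g.normalizeToSphere hg0 y = x₀ := fun y hy => by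
    ext1
    simp [ContinuousMap.normalizeToSphere, hgx₀ y hy]
  obtain ⟨p, hp, hgp⟩ := (contDiff_const.add hu :
    ContDiff ℝ 1 fun y => (x₀ : E) + u y).exists_mem_sphere_forall_smul_ne (by simpa using hN)
  have hmiss : ∀ y, g.normalizeToSphere hg0 y ≠ ⟨p, hp⟩ := fun y h =>
    hgp (val y) ‖g y‖⁻¹ (congrArg Subtype.val h)
  have hx₀ : x₀ ≠ ⟨p, hp⟩ := by
    have h0 : (0 : N → I) ∈ Cube.boundary N := ⟨Classical.arbitrary N, Or.inl rfl⟩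
    exact hbdry 0 h0 ▸ hmiss 0
  exact (f.1.homotopicRel_normalizeToSphere g hg0 hgf
    fun y hy => (hgx₀ y hy).trans (congrArg Subtype.val (f.2 y hy).symm)).trans
      (ContinuousMap.homotopicRel_const_of_forall_ne_s7 _ hmiss hx₀ hbdry)

/-- The homotopy groups of the unit sphere of `E` vanish in positive degrees less than the
dimension of the sphere. -/
theorem HomotopyGroup.subsingleton_sphere {N : Type*} [Fintype N] [Nonempty N]
    (hN : Fintype.card N + 1 < finrank ℝ E) (x₀ : sphere (0 : E) 1) :
    Subsingleton (HomotopyGroup N (sphere (0 : E) 1) x₀) :=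
  ⟨fun a b => Quotient.inductionOn₂ a b fun f g => Quotient.sound
    ((GenLoop.homotopic_const_sphere hN f).trans (GenLoop.homotopic_const_sphere hN g).symm)⟩

/-- The unit sphere of a real inner product space of dimension at least `3` is simply connected. -/
theorem simplyConnectedSpace_sphere (hE : 2 < finrank ℝ E) :
    SimplyConnectedSpace (sphere (0 : E) 1) := by
  refine simply_connected_iff_loops_nullhomotopic.2 ⟨?_, fun x γ => ?_⟩
  · refine isPathConnected_iff_pathConnectedSpace.1 (isPathConnected_sphere ?_ 0 zero_le_one)
    rw [← finrank_eq_rank]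
    exact_mod_cast (by omega : 1 < finrank ℝ E)
  · have := HomotopyGroup.subsingleton_sphere (N := Fin 1) (by simpa using hE) x
    have := (HomotopyGroup.pi1EquivFundamentalGroup (x := x)).symm.subsingleton
    exact Path.Homotopic.Quotient.exact
      (Subsingleton.elim (α := FundamentalGroup (sphere (0 : E) 1) x) _ _)

end Sphere

/-- The unit sphere `S⁷` in `ℂ⁴` is simply connected, and its homotopy groups
`π_i(S⁷)` are trivial for `1 ≤ i ≤ 6`. -/
theorem s7_six_connected :
    SimplyConnectedSpace (Metric.sphere (0 : EuclideanSpace ℂ (Fin 4)) 1) ∧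
    ∀ i : ℕ, 1 ≤ i → i ≤ 6 →
      ∀ x : Metric.sphere (0 : EuclideanSpace ℂ (Fin 4)) 1,
        Nonempty (HomotopyGroup (Fin i) (Metric.sphere (0 : EuclideanSpace ℂ (Fin 4)) 1) x) ∧
        Subsingleton (HomotopyGroup (Fin i) (Metric.sphere (0 : EuclideanSpace ℂ (Fin 4)) 1) x) := by
  have hdim : finrank ℝ (EuclideanSpace ℂ (Fin 4)) = 8 := by
    rw [finrank_real_of_complex, finrank_euclideanSpace_fin]
  refine ⟨simplyConnectedSpace_sphere (by omega), fun i hi hi6 x => ⟨inferInstance, ?_⟩⟩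
  have : NeZero i := ⟨by omega⟩
  exact HomotopyGroup.subsingleton_sphere (by rw [hdim, Fintype.card_fin]; omega) x
end

section
/- Let `Circle` denote the group of unit complex numbers with its subspace topology. Then for every $n \ge 2$, the homotopy group $\pi_n(\text{Circle})$ (at any basepoint) is trivial. -/
open scoped unitInterval Topology Topology.Homotopy

/-- A generalized loop of dimension at least two lifts through a covering map to a generalized
loop based at any prescribed point of the fibre. -/
theorem IsCoveringMap.exists_genLoop_lift {E X N : Type*} [TopologicalSpace E]
    [TopologicalSpace X] [Nontrivial N] {p : E → X} (hp : IsCoveringMap p) (e : E)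
    (f : Ω^ N X (p e)) : ∃ F : Ω^ N E e, ∀ y, p (F y) = f y := by
  classical
  let H : C(I × (I^N), X) := f.1.comp ⟨fun ty i ↦ ty.1 * ty.2 i, by fun_prop⟩
  have f_zero : f 0 = p e := f.2 0 ⟨Classical.arbitrary N, .inl rfl⟩
  have H_zero (y : I^N) : H (0, y) = p (ContinuousMap.const (I^N) e y) := by
    rw [ContinuousMap.const_apply, ← f_zero]
    exact congr_arg f (funext fun i ↦ zero_mul _)
  let L := hp.liftHomotopy H (.const _ e) H_zero
  have pL (ty : I × (I^N)) : p (L ty) = H ty := congr_fun (hp.liftHomotopy_lifts _ _ _) ty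
  let F : C(I^N, E) := L.comp (.prodMk (.const _ 1) (.id _))
  have pF (y : I^N) : p (F y) = f y :=
    (pL (1, y)).trans (congr_arg f (funext fun i ↦ one_mul _))
  have F_zero : F 0 = e := by
    have h : L (1, 0) = L (0, 0) :=
      hp.constOn_of_comp (s := Set.univ) (g := fun t ↦ L (t, 0)) isPreconnected_univ
        (by fun_prop) (fun s _ t _ ↦ by
          rw [pL, pL]
          exact congr_arg f (funext fun i ↦ (mul_zero s).trans (mul_zero t).symm))
        trivial trivial
    exact h.trans (hp.liftHomotopy_zero _ _ _ 0)
  have F_face (i : N) (c : I) (hc : c = 0 ∨ c = 1) (y z : I^N) :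
      F (Function.update y i c) = F (Function.update z i c) := by
    have f_face (y : I^N) : f (Function.update y i c) = p e :=
      f.2 _ ⟨i, by simpa using hc⟩
    exact hp.constOn_of_comp (s := Set.univ) (g := fun y ↦ F (Function.update y i c))
      isPreconnected_univ (by fun_prop) (fun y _ z _ ↦ by rw [pF, pF, f_face, f_face])
      trivial trivial
  refine ⟨⟨F, fun y ⟨i, hi⟩ ↦ ?_⟩, pF⟩
  obtain ⟨j, hj⟩ := exists_ne i
  calc F y = F (Function.update y i (y i)) := by rw [Function.update_eq_self]
    _ = F (Function.update 0 i (y i)) := F_face i _ hi _ _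
    _ = F (Function.update (Function.update 0 i (y i)) j 0) :=
      congr_arg F (Function.update_eq_self_iff.mpr (by simp [hj])).symm
    _ = F (Function.update 0 j 0) := F_face j 0 (.inl rfl) _ _
    _ = F 0 := congr_arg F (Function.update_eq_self_iff.mpr rfl)
    _ = e := F_zero

/-- Continuous maps into a real topological vector space that agree on a set are homotopic
relative to it. -/
theorem ContinuousMap.HomotopicRel.of_eqOn {X E : Type*} [TopologicalSpace X] [AddCommGroup E]
    [TopologicalSpace E] [IsTopologicalAddGroup E] [Module ℝ E] [ContinuousSMul ℝ E]
    {f g : C(X, E)} {S : Set X} (h : Set.EqOn f g S) : f.HomotopicRel g S :=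
  ⟨{ ContinuousMap.Homotopy.affine f g with
      prop' := fun t y hy ↦ by simp [← h hy] }⟩

/-- A space covered by a real topological vector space has trivial higher homotopy groups. -/
theorem IsCoveringMap.subsingleton_homotopyGroup {E X N : Type*} [TopologicalSpace X]
    [AddCommGroup E] [TopologicalSpace E] [IsTopologicalAddGroup E] [Module ℝ E]
    [ContinuousSMul ℝ E] [Nontrivial N] {p : E → X} (hp : IsCoveringMap p) (e : E) :
    Subsingleton (HomotopyGroup N X (p e)) := by
  refine ⟨Quotient.ind₂ fun f g ↦ Quotient.sound ?_⟩
  obtain ⟨F, hF⟩ := hp.exists_genLoop_lift e f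
  obtain ⟨G, hG⟩ := hp.exists_genLoop_lift e g
  have h : F.1.HomotopicRel G.1 (Cube.boundary N) :=
    .of_eqOn fun y hy ↦ (F.2 y hy).trans (G.2 y hy).symm
  have hf : (⟨p, hp.continuous⟩ : C(E, X)).comp F.1 = f.1 := ContinuousMap.ext hF
  have hg : (⟨p, hp.continuous⟩ : C(E, X)).comp G.1 = g.1 := ContinuousMap.ext hG
  change f.1.HomotopicRel g.1 (Cube.boundary N)
  rw [← hf, ← hg]
  exact h.comp_continuousMap _

/-- The higher homotopy groups `π_n(S¹)`, `n ≥ 2`, of the circle group of unit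
complex numbers are trivial. -/
theorem circle_higher_homotopy_trivial (n : ℕ) (hn : 2 ≤ n) (x : Circle) :
    Nonempty (HomotopyGroup (Fin n) Circle x) ∧
    Subsingleton (HomotopyGroup (Fin n) Circle x) := by
  have : Nontrivial (Fin n) := Fin.nontrivial_iff_two_le.mpr hn
  obtain ⟨t, rfl⟩ := Circle.exp_surjective x
  exact ⟨inferInstance, Circle.isCoveringMap_exp.subsingleton_homotopyGroup t⟩
end
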